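/- Let F be a field of characteristic not two and n ≥ 1. A bilinear map ⋆ : M_n(F) × M_n(F) → M_n(F) satisfies (A) associativity, (I) x⋆1 = x for all x, (T) tr(x⋆y) = tr(xy) for all x,y, and (O) x⋆y = 0 whenever x and y are rank-one idempotents with xy = yx = 0, if and only if either x⋆y = xy for all x,y ∈ M_n(F), or x⋆y = yx for all x,y ∈ M_n(F). -/

import Mathlib

open Matrix

section BilinearProduct

variable {F V : Type*} [Field F] [AddCommGroup V] [Module F V]

lemma eq_zero_of_add_self_eq_zero (h2 : (2 : F) ≠ 0) {x : V} (h : x + x = 0) : x = 0 :=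
  (smul_eq_zero.mp ((two_smul F x).trans h)).resolve_left h2

/-- If `e` is an idempotent of an associative product and `e`, `f` anticommute, then `e ⋆ f = 0`. -/
lemma product_eq_zero_of_anticommute (h2 : (2 : F) ≠ 0) {m : V →ₗ[F] V →ₗ[F] V}
    (hA : ∀ x y z, m x (m y z) = m (m x y) z) {e f : V} (he : m e e = e)
    (h : m e f + m f e = 0) : m e f = 0 := by
  have hl : m e f + m (m e f) e = 0 := by
    simpa [hA, he] using congrArg (m e) h
  have hr : m (m e f) e + m f e = 0 := by
    simpa [← hA, he] using congrArg (fun z => m z e) h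
  have hc : m e f = m f e := by
    rw [eq_neg_of_add_eq_zero_left hl, eq_neg_of_add_eq_zero_right hr]
  exact eq_zero_of_add_self_eq_zero h2 (by rwa [← hc] at h)

/-- Peirce components: for orthogonal idempotents `e`, `f` and `x` in the Peirce half-spaces of
both, `e ⋆ x ⋆ e = 0` and `e ⋆ x = x ⋆ f`. -/
lemma peirce_half_space {m : V →ₗ[F] V →ₗ[F] V}
    (hA : ∀ x y z, m x (m y z) = m (m x y) z) {e f x : V} (he : m e e = e)
    (hef : m e f = 0) (hex : m e x + m x e = x) (hfx : m f x + m x f = x) :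
    m (m e x) e = 0 ∧ m e x = m x f := by
  have h : m (m e x) e = 0 := by
    have := congrArg (m e) hex
    simpa [hA, he] using this
  refine ⟨h, ?_⟩
  have hl : m (m e x) f = m e x := by
    simpa [hA, hef] using congrArg (m e) hfx
  have hr : m (m e x) f = m x f := by
    simpa [← hA, hef] using congrArg (fun z => m z f) hex
  rw [← hl, hr]

/-- If `e` is a right unit of `x`, `f` a left unit of `y` and `e ⋆ f = 0`, then `x ⋆ y = 0`. -/
lemma product_eq_zero_of_orthogonal_units {m : V →ₗ[F] V →ₗ[F] V} {e f x y : V}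
    (hA : ∀ x y z, m x (m y z) = m (m x y) z) (hx : m x e = x) (hy : m f y = y)
    (hef : m e f = 0) : m x y = 0 := by
  rw [← hx, ← hy, ← hA, hA e, hef]
  simp

end BilinearProduct

section JordanProduct

variable {F ι : Type*} [Field F] [Fintype ι] [DecidableEq ι]

/-- Two bilinear maps on matrices agreeing on matrix units are equal. -/
lemma bilinear_ext_single {m m' : Matrix ι ι F →ₗ[F] Matrix ι ι F →ₗ[F] Matrix ι ι F}
    (h : ∀ i j k l, m (single i j 1) (single k l 1) = m' (single i j 1) (single k l 1)) :
    m = m' := by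
  refine Matrix.ext_linearMap _ fun i j => LinearMap.ext_ring ?_
  refine Matrix.ext_linearMap _ fun k l => LinearMap.ext_ring ?_
  simpa using h i j k l

variable {m : Matrix ι ι F →ₗ[F] Matrix ι ι F →ₗ[F] Matrix ι ι F}

lemma single_product_self (h2 : (2 : F) ≠ 0) (hJ : ∀ x y, m x y + m y x = x * y + y * x) (i : ι) :
    m (single i i 1) (single i i 1) = single i i 1 := by
  have h := hJ (single i i 1) (single i i 1)
  rw [← sub_eq_zero]
  refine eq_zero_of_add_self_eq_zero h2 ?_
  rw [single_mul_single_same, mul_one] at h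
  rw [← sub_eq_zero] at h
  rw [← h]
  abel

lemma single_product_single_diag_of_ne (h2 : (2 : F) ≠ 0)
    (hA : ∀ x y z, m x (m y z) = m (m x y) z)
    (hJ : ∀ x y, m x y + m y x = x * y + y * x) {i j : ι} (hij : i ≠ j) :
    m (single i i 1) (single j j 1) = 0 :=
  product_eq_zero_of_anticommute h2 hA (single_product_self h2 hJ i)
    (by rw [hJ]; simp [hij, hij.symm])

/-- The matrix unit `single i j 1` has left unit `single i i 1` and right unit `single j j 1`
for the product `m`. -/
def IsPeirceOriented (m : Matrix ι ι F →ₗ[F] Matrix ι ι F →ₗ[F] Matrix ι ι F) (i j : ι) : Prop :=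
  m (single i i 1) (single i j 1) = single i j 1 ∧ m (single i j 1) (single j j 1) = single i j 1

lemma eq_smul_single_of_jordan {M : Matrix ι ι F} {i j : ι} (hij : i ≠ j)
    (hi : single i i 1 * M + M * single i i 1 = M)
    (hj : single j j 1 * M + M * single j j 1 = M)
    (h : M * single i j 1 + single i j 1 * M = 0) : M = M i j • single i j 1 := by
  have hentry : ∀ k, single k k 1 * M + M * single k k 1 = M → ∀ a b,
      (if a = k then M a b else 0) + (if b = k then M a b else 0) = M a b := by
    intro k hk a b
    have := congrFun (congrFun hk a) b
    rw [Matrix.add_apply] at this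
    refine Eq.trans ?_ this
    congr 1
    · split_ifs with h'
      · subst h'; simp
      · simp [h']
    · split_ifs with h'
      · subst h'; simp
      · simp [h']
  have hji : M j i = 0 := by
    have := congrFun (congrFun h i) i
    simpa [hij] using this
  ext a b
  have h1 := hentry i hi a b
  have h2 := hentry j hj a b
  simp only [Matrix.smul_apply, Matrix.single_apply, smul_eq_mul]
  grind

/-- Each matrix unit keeps its ordinary Peirce orientation or has it reversed. -/
lemma isPeirceOriented_or_flip (h2 : (2 : F) ≠ 0)
    (hA : ∀ x y z, m x (m y z) = m (m x y) z)
    (hJ : ∀ x y, m x y + m y x = x * y + y * x) {i j : ι} (hij : i ≠ j) :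
    IsPeirceOriented m i j ∨ IsPeirceOriented m.flip i j := by
  have hei := single_product_self h2 hJ i
  have hej := single_product_self h2 hJ j
  have hef := single_product_single_diag_of_ne h2 hA hJ hij
  have hfe := single_product_single_diag_of_ne h2 hA hJ hij.symm
  have hex : m (single i i 1) (single i j 1) + m (single i j 1) (single i i 1) = single i j 1 := by
    rw [hJ]; simp [hij.symm]
  have hfx : m (single j j 1) (single i j 1) + m (single i j 1) (single j j 1) = single i j 1 := by
    rw [hJ]; simp [hij.symm]
  have hxx : m (single i j 1) (single i j 1) = 0 :=
    eq_zero_of_add_self_eq_zero h2 (by rw [hJ]; simp [hij.symm])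
  obtain ⟨hexe, hexf⟩ := peirce_half_space hA hei hef hex hfx
  obtain ⟨-, hfxe⟩ := peirce_half_space hA hej hfe hfx hex
  unfold IsPeirceOriented
  simp only [LinearMap.flip_apply]
  generalize hM : m (single i i 1) (single i j 1) = M at *
  have heM : m (single i i 1) M = M := by rw [← hM, hA, hei]
  have hfM : m (single j j 1) M = 0 := by rw [← hM, hA, hfe]; simp
  have hMf : m M (single j j 1) = M := by rw [hexf, ← hA, hej]
  have hMx : m M (single i j 1) = 0 := by rw [← hM, ← hA, hxx, map_zero]
  have hxM : m (single i j 1) M = 0 := by rw [hexf, hA, hxx]; simp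
  have hsmul : M = M i j • single i j 1 := by
    refine eq_smul_single_of_jordan hij ?_ ?_ ?_
    · rw [← hJ, heM, hexe, add_zero]
    · rw [← hJ, hfM, hMf, zero_add]
    · rw [← hJ, hMx, hxM, add_zero]
  have hMM : M = M i j • M := by
    conv_lhs => rw [← heM, hsmul]
    rw [map_smul, hM]
  have hcases : (1 - M i j) • M = 0 := by rw [sub_smul, one_smul, ← hMM, sub_self]
  rcases smul_eq_zero.mp hcases with h1 | h0
  · left
    rw [← sub_eq_zero.mp h1, one_smul] at hsmul
    exact ⟨hsmul, hexf ▸ hsmul⟩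
  · right
    rw [h0, zero_add] at hex
    exact ⟨hex, hfxe.trans hex⟩

/-- Consecutive matrix units cannot have opposite orientations. -/
lemma not_isPeirceOriented_flip (h2 : (2 : F) ≠ 0)
    (hA : ∀ x y z, m x (m y z) = m (m x y) z)
    (hJ : ∀ x y, m x y + m y x = x * y + y * x) {i j k : ι} (hij : i ≠ j) (hjk : j ≠ k)
    (h : IsPeirceOriented m i j) (h' : IsPeirceOriented m.flip j k) : False := by
  obtain ⟨hl, hr⟩ := h
  obtain ⟨hl', hr'⟩ := h'
  rw [LinearMap.flip_apply] at hl' hr'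
  have hxy := product_eq_zero_of_orthogonal_units hA hr hr'
    (single_product_single_diag_of_ne h2 hA hJ hjk)
  have hyx := product_eq_zero_of_orthogonal_units hA hl' hl
    (single_product_single_diag_of_ne h2 hA hJ hij.symm)
  have hsum := hJ (single i j 1) (single j k 1)
  rw [hxy, hyx, single_mul_single_same] at hsum
  have := congrFun (congrFun hsum i) k
  simp [hij] at this

/-- Either all off-diagonal matrix units keep their orientation or all have it reversed. -/
lemma forall_isPeirceOriented_or_flip (h2 : (2 : F) ≠ 0)
    (hA : ∀ x y z, m x (m y z) = m (m x y) z)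
    (hJ : ∀ x y, m x y + m y x = x * y + y * x) :
    (∀ i j, i ≠ j → IsPeirceOriented m i j) ∨ (∀ i j, i ≠ j → IsPeirceOriented m.flip i j) := by
  have hdich := fun {i j : ι} => isPeirceOriented_or_flip (i := i) (j := j) h2 hA hJ
  have hstep : ∀ {i j k : ι}, i ≠ j → j ≠ k → IsPeirceOriented m i j → IsPeirceOriented m j k :=
    fun hij hjk h => (hdich hjk).resolve_right (not_isPeirceOriented_flip h2 hA hJ hij hjk h)
  by_contra! hcon
  obtain ⟨⟨i, j, hij, hnot⟩, k, l, hkl, hnot'⟩ := hcon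
  have hor := (hdich hkl).resolve_right hnot'
  apply hnot
  by_cases hli : l = i
  · subst hli
    exact hstep hkl hij hor
  · exact hstep hli hij (hstep hkl hli hor)

lemma eq_mul_of_forall_isPeirceOriented (h2 : (2 : F) ≠ 0)
    (hA : ∀ x y z, m x (m y z) = m (m x y) z)
    (hJ : ∀ x y, m x y + m y x = x * y + y * x)
    (h : ∀ i j, i ≠ j → IsPeirceOriented m i j) (x y : Matrix ι ι F) : m x y = x * y := by
  have hor : ∀ i j, IsPeirceOriented m i j := by
    intro i j
    by_cases hij : i = j
    · subst hij
      exact ⟨single_product_self h2 hJ i, single_product_self h2 hJ i⟩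
    · exact h i j hij
  have hzero : ∀ i j k l, j ≠ k → m (single i j 1) (single k l 1) = 0 := fun i j k l hjk =>
    product_eq_zero_of_orthogonal_units hA (hor i j).2 (hor k l).1
      (single_product_single_diag_of_ne h2 hA hJ hjk)
  suffices m = LinearMap.mul F (Matrix ι ι F) by rw [this, LinearMap.mul_apply']
  refine bilinear_ext_single fun i j k l => ?_
  rw [LinearMap.mul_apply']
  by_cases hjk : j = k
  · subst hjk
    have hsum := hJ (single i j 1) (single j l 1)
    by_cases hli : l = i
    · subst hli
      by_cases hlj : l = j
      · subst hlj
        simpa using single_product_self h2 hJ l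
      · have := congrArg (m (single l l 1)) hsum
        rw [map_add, map_add, hA, (hor l j).1, hA, hzero l l j l hlj] at this
        simpa [hzero l l j j hlj, (hor l l).1] using this
    · rw [hzero j l i j hli, single_mul_single_of_ne _ _ _ _ hli] at hsum
      simpa using hsum
  · rw [hzero i j k l hjk, single_mul_single_of_ne _ _ _ _ hjk]

/-- An associative product with the same Jordan product as matrix multiplication is matrix
multiplication or its opposite. -/
theorem eq_mul_or_eq_mul_swap_of_jordan (h2 : (2 : F) ≠ 0)
    (hA : ∀ x y z, m x (m y z) = m (m x y) z)
    (hJ : ∀ x y, m x y + m y x = x * y + y * x) :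
    (∀ x y, m x y = x * y) ∨ (∀ x y, m x y = y * x) := by
  rcases forall_isPeirceOriented_or_flip h2 hA hJ with h | h
  · exact Or.inl (eq_mul_of_forall_isPeirceOriented h2 hA hJ h)
  · refine Or.inr fun x y => eq_mul_of_forall_isPeirceOriented (m := m.flip) h2 ?_ ?_ h y x
    · intro x y z
      simp [hA]
    · intro x y
      simpa [add_comm] using hJ x y

end JordanProduct

section Dyads

variable {F ι : Type*} [Field F]

/-- A symmetric bilinear map vanishing on squares of dyads is alternating in the second factors. -/
lemma dyad_exchange (h2 : (2 : F) ≠ 0) {D : Matrix ι ι F →ₗ[F] Matrix ι ι F →ₗ[F] Matrix ι ι F}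
    (hsymm : ∀ x y, D x y = D y x) (hD : ∀ p q, D (vecMulVec p q) (vecMulVec p q) = 0) :
    (∀ p p' q, D (vecMulVec p q) (vecMulVec p' q) = 0) ∧
    (∀ p q q', D (vecMulVec p q) (vecMulVec p q') = 0) ∧
    (∀ p p' q q', D (vecMulVec p q) (vecMulVec p' q') = - D (vecMulVec p q') (vecMulVec p' q)) := by
  have hleft : ∀ p p' q, D (vecMulVec p q) (vecMulVec p' q) = 0 := by
    intro p p' q
    have h := hD (p + p') q
    simp only [add_vecMulVec, map_add, LinearMap.add_apply, hD, zero_add, add_zero] at h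
    rw [hsymm (vecMulVec p' q)] at h
    exact eq_zero_of_add_self_eq_zero h2 h
  refine ⟨hleft, ?_, ?_⟩
  · intro p q q'
    have h := hD p (q + q')
    simp only [vecMulVec_add, map_add, LinearMap.add_apply, hD, zero_add, add_zero] at h
    rw [hsymm (vecMulVec p q')] at h
    exact eq_zero_of_add_self_eq_zero h2 h
  · intro p p' q q'
    have h := hleft p p' (q + q')
    simp only [vecMulVec_add, map_add, LinearMap.add_apply, hleft, zero_add, add_zero] at h
    rw [eq_neg_iff_add_eq_zero, add_comm]
    exact h

end Dyads

section Orthogonality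

variable {F ι : Type*} [Field F] [Fintype ι] [DecidableEq ι]

lemma rank_vecMulVec_of_dotProduct_eq_one {p q : ι → F} (h : q ⬝ᵥ p = 1) :
    (vecMulVec p q).rank = 1 := by
  refine le_antisymm (rank_vecMulVec_le p q) (Nat.one_le_iff_ne_zero.mpr fun h0 => ?_)
  have hz : vecMulVec p q = 0 := by
    rw [Matrix.rank, Submodule.finrank_eq_zero, LinearMap.range_eq_bot] at h0
    exact Matrix.toLin'.injective (by rw [Matrix.toLin'_apply', h0, map_zero])
  rcases vecMulVec_eq_zero.mp hz with rfl | rfl <;> simp at h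

lemma exists_dotProduct_eq_one {q : ι → F} (hq : q ≠ 0) : ∃ w, q ⬝ᵥ w = 1 := by
  obtain ⟨a, ha⟩ := Function.ne_iff.mp hq
  refine ⟨Pi.single a (q a)⁻¹, ?_⟩
  simpa using mul_inv_cancel₀ ha

/-- The complement of a rank-one idempotent as a sum of dyads orthogonal to it. -/
lemma one_sub_vecMulVec_eq_sum {p q : ι → F} (h : q ⬝ᵥ p = 1) :
    1 - vecMulVec p q =
      ∑ a, vecMulVec (Pi.single a 1 - q a • p) (Pi.single a 1 - p a • q) := by
  ext b c
  have hs : ∑ a, q a * p a = 1 := h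
  have hexpand : ∀ a, vecMulVec (Pi.single a 1 - q a • p) (Pi.single a 1 - p a • q) b c =
      (Pi.single a 1 : ι → F) b * (Pi.single a 1 : ι → F) c
        - (Pi.single a 1 : ι → F) b * p a * q c - (Pi.single a 1 : ι → F) c * q a * p b
        + q a * p a * (p b * q c) := by
    intro a
    simp only [vecMulVec_apply, Pi.sub_apply, Pi.smul_apply, smul_eq_mul]
    ring
  rw [Matrix.sum_apply]
  simp only [hexpand, Finset.sum_add_distrib, Finset.sum_sub_distrib, ← Finset.sum_mul, hs]
  simp [Pi.single_apply, Matrix.one_apply, vecMulVec_apply]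
  ring

variable {m : Matrix ι ι F →ₗ[F] Matrix ι ι F →ₗ[F] Matrix ι ι F}

/-- `m` vanishes on pairs of orthogonal rank-one idempotents, written as dyads. -/
def VanishesOnOrthogonalDyads
    (m : Matrix ι ι F →ₗ[F] Matrix ι ι F →ₗ[F] Matrix ι ι F) : Prop :=
  ∀ p q u v : ι → F, q ⬝ᵥ p = 1 → v ⬝ᵥ u = 1 → q ⬝ᵥ u = 0 → v ⬝ᵥ p = 0 →
    m (vecMulVec p q) (vecMulVec u v) = 0

/-- The second dyad need not be idempotent. -/
lemma VanishesOnOrthogonalDyads.product_eq_zero (hO : VanishesOnOrthogonalDyads m)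
    {p q u v : ι → F} (hqp : q ⬝ᵥ p = 1) (hqu : q ⬝ᵥ u = 0) (hvp : v ⬝ᵥ p = 0) :
    m (vecMulVec p q) (vecMulVec u v) = 0 := by
  have hne : ∀ w : ι → F, q ⬝ᵥ w = 0 → v ⬝ᵥ w ≠ 0 → m (vecMulVec p q) (vecMulVec w v) = 0 := by
    intro w hqw hvw
    have := hO p q ((v ⬝ᵥ w)⁻¹ • w) v hqp (by simp [hvw]) (by simp [hqw]) hvp
    rw [smul_vecMulVec, map_smul] at this
    exact (smul_eq_zero.mp this).resolve_left (inv_ne_zero hvw)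
  by_cases hvu : v ⬝ᵥ u = 0
  · by_cases hv : v = 0
    · simp [hv]
    obtain ⟨w, hw⟩ := exists_dotProduct_eq_one hv
    have hqw : q ⬝ᵥ (w - (q ⬝ᵥ w) • p) = 0 := by simp [dotProduct_sub, hqp]
    have hvw : v ⬝ᵥ (w - (q ⬝ᵥ w) • p) = 1 := by simp [dotProduct_sub, hvp, hw]
    have hsum := hne (u + (w - (q ⬝ᵥ w) • p)) (by rw [dotProduct_add, hqu, hqw, add_zero])
      (by simp [dotProduct_add, hvu, hvw])
    rwa [add_vecMulVec, map_add, hne _ hqw (by simp [hvw]), add_zero] at hsum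
  · exact hne u hqu hvu

lemma VanishesOnOrthogonalDyads.product_self (hO : VanishesOnOrthogonalDyads m)
    (hI : ∀ x, m x 1 = x) {p q : ι → F} (h : q ⬝ᵥ p = 1) :
    m (vecMulVec p q) (vecMulVec p q) = vecMulVec p q := by
  have hz : m (vecMulVec p q) (1 - vecMulVec p q) = 0 := by
    rw [one_sub_vecMulVec_eq_sum h, map_sum]
    refine Finset.sum_eq_zero fun a _ => hO.product_eq_zero h ?_ ?_
    · simp [dotProduct_sub, h]
    · simp [sub_dotProduct, h]
  rw [map_sub, hI, sub_eq_zero] at hz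
  exact hz.symm

lemma VanishesOnOrthogonalDyads.sq_dyad (h2 : (2 : F) ≠ 0) (hO : VanishesOnOrthogonalDyads m)
    (hI : ∀ x, m x 1 = x) (p q : ι → F) :
    m (vecMulVec p q) (vecMulVec p q) = vecMulVec p q * vecMulVec p q := by
  rw [vecMulVec_mul_vecMulVec, vecMulVec_smul]
  have hne : ∀ w : ι → F, q ⬝ᵥ w ≠ 0 →
      m (vecMulVec w q) (vecMulVec w q) = (q ⬝ᵥ w) • vecMulVec w q := by
    intro w hw
    have := hO.product_self hI (p := (q ⬝ᵥ w)⁻¹ • w) (q := q) (by simp [hw])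
    rw [smul_vecMulVec, map_smul, map_smul, LinearMap.smul_apply] at this
    have h' := congrArg (fun z => (q ⬝ᵥ w) • (q ⬝ᵥ w) • z) this
    simpa [smul_smul, hw] using h'
  by_cases hqp : q ⬝ᵥ p = 0
  · by_cases hq : q = 0
    · simp [hq]
    obtain ⟨w, hw⟩ := exists_dotProduct_eq_one hq
    have hadd := hne (p + w) (by simp [dotProduct_add, hqp, hw])
    have hsub := hne (p - w) (by simp [dotProduct_sub, hqp, hw])
    have hself := hne w (by simp [hw])
    rw [hqp, zero_smul]
    refine eq_zero_of_add_self_eq_zero h2 ?_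
    simp only [add_vecMulVec, sub_vecMulVec, map_add, map_sub, LinearMap.add_apply,
      LinearMap.sub_apply, dotProduct_add, dotProduct_sub, hqp, hw, hself, zero_add, zero_sub,
      neg_smul, one_smul] at hadd hsub
    have := congrArg₂ (· + ·) hadd hsub
    rw [← sub_eq_zero] at this
    rw [← this]
    abel
  · exact hne p hqp

/-- The product of two matrix units sharing no index across the pair vanishes. -/
lemma VanishesOnOrthogonalDyads.product_single (hO : VanishesOnOrthogonalDyads m)
    {i j k l : ι} (hik : i ≠ k) (hjk : j ≠ k) (hli : l ≠ i) :
    m (single i j 1) (single k l 1) = 0 := by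
  rw [single_eq_single_vecMulVec_single, single_eq_single_vecMulVec_single k l]
  have hdiag : m (vecMulVec (Pi.single i 1) (Pi.single i 1))
      (vecMulVec (Pi.single k 1) (Pi.single l 1)) = 0 :=
    hO.product_eq_zero (by simp) (by simp [hik]) (by simp [hli.symm])
  by_cases hij : i = j
  · subst hij
    exact hdiag
  have hsum : m (vecMulVec (Pi.single i 1) (Pi.single i 1 + Pi.single j 1))
      (vecMulVec (Pi.single k 1) (Pi.single l 1)) = 0 :=
    hO.product_eq_zero (by simp [hij]) (by simp [hik, hjk]) (by simp [hli.symm])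
  rwa [vecMulVec_add, map_add, LinearMap.add_apply, hdiag, zero_add] at hsum

/-- A product with right unit `1` that vanishes on orthogonal rank-one idempotents has the same
Jordan product as matrix multiplication. -/
theorem VanishesOnOrthogonalDyads.jordan (h2 : (2 : F) ≠ 0) (hO : VanishesOnOrthogonalDyads m)
    (hI : ∀ x, m x 1 = x) (x y : Matrix ι ι F) : m x y + m y x = x * y + y * x := by
  let μ := LinearMap.mul F (Matrix ι ι F)
  let D := (m + m.flip) - (μ + μ.flip)
  have hDapply : ∀ x y, D x y = (m x y + m y x) - (x * y + y * x) := fun _ _ => rfl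
  suffices D = 0 by
    rw [← sub_eq_zero, ← hDapply, this]
    rfl
  obtain ⟨hleft, hright, hswap⟩ := dyad_exchange h2 (D := D)
    (fun x y => by rw [hDapply, hDapply, add_comm (m x y), add_comm (x * y)])
    (fun p q => by rw [hDapply, hO.sq_dyad h2 hI, sub_self])
  have hzero : ∀ i j k l, i ≠ k → j ≠ k → l ≠ i → D (single i j 1) (single k l 1) = 0 := by
    intro i j k l hik hjk hli
    rw [hDapply, hO.product_single hik hjk hli, hO.product_single hik.symm hli hjk,
      single_mul_single_of_ne _ _ _ _ hjk, single_mul_single_of_ne _ _ _ _ hli, sub_self]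
  refine bilinear_ext_single fun i j k l => ?_
  rw [LinearMap.zero_apply, LinearMap.zero_apply]
  by_cases hik : i = k
  · subst hik
    simp only [single_eq_single_vecMulVec_single, hright]
  by_cases hjl : j = l
  · subst hjl
    simp only [single_eq_single_vecMulVec_single, hleft]
  by_cases hcross : j ≠ k ∧ l ≠ i
  · exact hzero i j k l hik hcross.1 hcross.2
  · have := hzero i l k j hik (by grind) (by grind)
    simp only [single_eq_single_vecMulVec_single] at this ⊢
    rw [hswap, this, neg_zero]

end Orthogonality

/-- Matrix multiplication is determined by orthogonality and trace:
a bilinear map `⋆` on `n × n` matrices over a field of characteristic `≠ 2`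
satisfies (A) associativity, (I) identity, (T) trace, and (O) orthogonality
if and only if it is ordinary matrix multiplication or its opposite. -/
theorem stmt_0 {F : Type*} [Field F] (h2 : (2 : F) ≠ 0) {n : ℕ} (hn : 1 ≤ n)
    (star : Matrix (Fin n) (Fin n) F → Matrix (Fin n) (Fin n) F → Matrix (Fin n) (Fin n) F)
    (hB1 : ∀ (c : F) (x y : Matrix (Fin n) (Fin n) F), star (c • x) y = c • star x y)
    (hB2 : ∀ (c : F) (x y : Matrix (Fin n) (Fin n) F), star x (c • y) = c • star x y)
    (hB3 : ∀ x y z : Matrix (Fin n) (Fin n) F, star (x + y) z = star x z + star y z)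
    (hB4 : ∀ x y z : Matrix (Fin n) (Fin n) F, star x (y + z) = star x y + star x z) :
    ((∀ x y z : Matrix (Fin n) (Fin n) F, star x (star y z) = star (star x y) z) ∧
     (∀ x : Matrix (Fin n) (Fin n) F, star x 1 = x) ∧
     (∀ x y : Matrix (Fin n) (Fin n) F, (star x y).trace = (x * y).trace) ∧
     (∀ x y : Matrix (Fin n) (Fin n) F,
        x * x = x → y * y = y → x.rank = 1 → y.rank = 1 →
        x * y = 0 → y * x = 0 → star x y = 0)) ↔
    ((∀ x y : Matrix (Fin n) (Fin n) F, star x y = x * y) ∨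
     (∀ x y : Matrix (Fin n) (Fin n) F, star x y = y * x)) := by
  constructor
  · rintro ⟨hA, hI, -, hO⟩
    let m := LinearMap.mk₂ F star hB3 hB1 hB4 hB2
    have hdyads : VanishesOnOrthogonalDyads m := by
      intro p q u v hqp hvu hqu hvp
      refine hO _ _ ?_ ?_ (rank_vecMulVec_of_dotProduct_eq_one hqp)
        (rank_vecMulVec_of_dotProduct_eq_one hvu) ?_ ?_ <;>
      simp [vecMulVec_mul_vecMulVec, hqp, hvu, hqu, hvp]
    exact eq_mul_or_eq_mul_swap_of_jordan (m := m) h2 hA (hdyads.jordan h2 hI)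
  · rintro (h | h)
    · refine ⟨fun x y z => ?_, fun x => ?_, fun x y => ?_, fun x y _ _ _ _ hxy _ => ?_⟩
      · simp only [h, mul_assoc]
      · rw [h, mul_one]
      · rw [h]
      · rw [h, hxy]
    · refine ⟨fun x y z => ?_, fun x => ?_, fun x y => ?_, fun x y _ _ _ _ _ hyx => ?_⟩
      · simp only [h, mul_assoc]
      · rw [h, one_mul]
      · rw [h, trace_mul_comm]
      · rw [h, hyx]
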